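/- If q ≥ q*(k,σ), then there exists a unique global solution z ∈ C²((0,∞)) ∩ C¹([0,∞)) of the initial value problem (τ^{n-k}(z'(τ))^k)' = τ^{n-1+σ}(-z(τ))^q for τ > 0, with z(0) = -1 and z'(0) = 0. -/

import Mathlib

open Real Set Filter MeasureTheory

noncomputable section

/-- `c_{n,k} = (1/n) * binom(n,k)`. -/
def cnk (n k : ℕ) : ℝ := (n.choose k : ℝ) / n

/-- The critical exponent `q*(k,σ) = ((n+2)k + σ(k+1))/(n-2k)`. -/
def qstar (n k : ℕ) (σ : ℝ) : ℝ :=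
  (((n : ℝ) + 2) * k + σ * ((k : ℝ) + 1)) / ((n : ℝ) - 2 * k)

/-- The Joseph–Lundgren type exponent `q_JL(k,σ)` (finite formula, valid
for `n > 2k + 8 + 4σ/k`). -/
def qJL (n k : ℕ) (σ : ℝ) : ℝ :=
  (k : ℝ) *
    (((k : ℝ) * ((k : ℝ) + 1) * n - (k : ℝ) ^ 2 * (2 - σ) + 2 * k + σ -
        2 * Real.sqrt ((k : ℝ) * (2 * k + σ) * (((k : ℝ) + 1) * n - (k : ℝ) * (2 - σ)))) /
      ((k : ℝ) * ((k : ℝ) + 1) * n - 2 * (k : ℝ) ^ 2 * ((k : ℝ) + 3) - 2 * k * σ -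
        2 * Real.sqrt ((k : ℝ) * (2 * k + σ) * (((k : ℝ) + 1) * n - (k : ℝ) * (2 - σ)))))

/-- `λ̃(k,σ) = c_{n,k} τ_σ^k (n - 2k - k τ_σ)` with `τ_σ = (2k+σ)/(q-k)`. -/
def lamTilde (n k : ℕ) (q σ : ℝ) : ℝ :=
  cnk n k * ((2 * (k : ℝ) + σ) / (q - k)) ^ k *
    ((n : ℝ) - 2 * k - (k : ℝ) * ((2 * (k : ℝ) + σ) / (q - k)))

/-- `μ*(k,σ) = binom(n,k) ((n+σ)/n) (n-2k)^k / (k+1)^{k+1}`. -/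
def muStar (n k : ℕ) (σ : ℝ) : ℝ :=
  (n.choose k : ℝ) * (((n : ℝ) + σ) / n) * ((n : ℝ) - 2 * k) ^ k / ((k : ℝ) + 1) ^ (k + 1)

/-- A classical radial solution of problem `(P_λ)`:
`u ∈ C²((0,1)) ∩ C¹([0,1])`, `u'(0) = 0`, `u(1) = 0`, `u < 0` on `(0,1)`,
`(r^{n-i} (u')^i)' ≥ 0` on `(0,1)` for `i = 1,…,k`, and
`c_{n,k} r^{1-n} (r^{n-k}(u')^k)' = λ r^σ (1-u)^q` on `(0,1)`. -/
def IsRadialSol (n k : ℕ) (q σ lam : ℝ) (u : ℝ → ℝ) : Prop :=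
  ContDiffOn ℝ 2 u (Ioo 0 1) ∧ ContDiffOn ℝ 1 u (Icc 0 1) ∧
  deriv u 0 = 0 ∧ u 1 = 0 ∧
  (∀ r ∈ Ioo (0:ℝ) 1, u r < 0) ∧
  (∀ i : ℕ, 1 ≤ i → i ≤ k →
    ∀ r ∈ Ioo (0:ℝ) 1, 0 ≤ deriv (fun s => s ^ ((n : ℝ) - i) * (deriv u s) ^ i) r) ∧
  (∀ r ∈ Ioo (0:ℝ) 1,
    cnk n k * r ^ (1 - (n : ℝ)) *
        deriv (fun s => s ^ ((n : ℝ) - k) * (deriv u s) ^ k) r =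
      lam * r ^ σ * (1 - u r) ^ q)

/-- A radial subsolution of `(P_λ)`. -/
def IsRadialSubsol (n k : ℕ) (q σ lam : ℝ) (u : ℝ → ℝ) : Prop :=
  ContDiffOn ℝ 2 u (Ioo 0 1) ∧ ContDiffOn ℝ 1 u (Icc 0 1) ∧
  (∀ i : ℕ, 1 ≤ i → i ≤ k →
    ∀ r ∈ Ioo (0:ℝ) 1, 0 ≤ deriv (fun s => s ^ ((n : ℝ) - i) * (deriv u s) ^ i) r) ∧
  (∀ r ∈ Ioo (0:ℝ) 1,
    lam * r ^ σ * (1 - u r) ^ q ≤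
      cnk n k * r ^ (1 - (n : ℝ)) *
        deriv (fun s => s ^ ((n : ℝ) - k) * (deriv u s) ^ k) r) ∧
  u 1 ≤ 0

/-- A global solution of the initial value problem
`(τ^{n-k}(z')^k)' = τ^{n-1+σ}(-z)^q`, `z(0) = -1`, `z'(0) = 0`, with `-z > 0` along the
solution, in the regularity class `C²((0,∞)) ∩ C¹([0,∞))`. -/
def IsIVPSol (n k : ℕ) (q σ : ℝ) (z : ℝ → ℝ) : Prop :=
  ContDiffOn ℝ 2 z (Ioi 0) ∧ ContDiffOn ℝ 1 z (Ici 0) ∧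
  z 0 = -1 ∧ deriv z 0 = 0 ∧ (∀ τ : ℝ, 0 ≤ τ → z τ < 0) ∧
  ∀ τ : ℝ, 0 < τ →
    deriv (fun s => s ^ ((n : ℝ) - k) * (deriv z s) ^ k) τ =
      τ ^ ((n : ℝ) - 1 + σ) * (-z τ) ^ q

def fq (q x : ℝ) : ℝ := (max x 0) ^ q
def Aop (N q : ℝ) (w : ℝ → ℝ) (s : ℝ) : ℝ := ∫ u in (0:ℝ)..1, u ^ (N - 1) * fq q (w (s * u))
def Tp (N q β κ : ℝ) (w : ℝ → ℝ) (τ : ℝ) : ℝ :=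
  1 - ∫ s in (0:ℝ)..τ, (max s 0) ^ β * (Aop N q w s) ^ κ

lemma fq_cont {q : ℝ} (hq : 0 ≤ q) : Continuous (fq q) := by
  unfold fq
  exact (continuous_id.max continuous_const).rpow_const (fun _ => Or.inr hq)

lemma fq_nonneg (q x : ℝ) : 0 ≤ fq q x := Real.rpow_nonneg (le_max_right _ _) _

lemma fq_le_one {q x : ℝ} (hq : 0 ≤ q) (hx : x ≤ 1) : fq q x ≤ 1 :=
  Real.rpow_le_one (le_max_right _ _) (max_le hx zero_le_one) hq

lemma fq_of_nonneg {q x : ℝ} (hx : 0 ≤ x) : fq q x = x ^ q := by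
  unfold fq; rw [max_eq_left hx]

lemma fq_hasDerivAt {q : ℝ} (hq : 1 < q) (x : ℝ) : HasDerivAt (fq q) (q * fq (q - 1) x) x := by
  have key : ∀ y : ℝ, y ≠ 0 → HasDerivAt (fq q) (q * fq (q - 1) y) y := by
    intro y hy
    rcases lt_or_gt_of_ne hy with h | h
    · have h1 : fq (q-1) y = 0 := by
        unfold fq; rw [max_eq_right h.le, Real.zero_rpow (by linarith)]
      rw [h1, mul_zero]
      refine (hasDerivAt_const y (0:ℝ)).congr_of_eventuallyEq ?_
      filter_upwards [Iio_mem_nhds h] with t ht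
      unfold fq; rw [max_eq_right (le_of_lt ht), Real.zero_rpow (by linarith)]
    · rw [fq_of_nonneg h.le]
      refine (Real.hasDerivAt_rpow_const (Or.inl hy)).congr_of_eventuallyEq ?_
      filter_upwards [Ioi_mem_nhds h] with t ht
      exact fq_of_nonneg (le_of_lt ht)
  by_cases hx : x = 0
  · subst hx
    exact hasDerivAt_of_hasDerivAt_of_ne key (fq_cont (by linarith)).continuousAt
      (continuous_const.mul (fq_cont (by linarith))).continuousAt
  · exact key x hx

lemma fq_lip {q : ℝ} (hq : 1 < q) {a b : ℝ} (ha : a ≤ 1) (hb : b ≤ 1) :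
    |fq q a - fq q b| ≤ q * |a - b| := by
  have := (convex_Iic (1:ℝ)).norm_image_sub_le_of_norm_hasDerivWithin_le (f := fq q)
    (f' := fun x => q * fq (q-1) x) (C := q)
    (fun x _ => (fq_hasDerivAt hq x).hasDerivWithinAt) (fun x hx => by
      rw [Real.norm_eq_abs, abs_of_nonneg (mul_nonneg (by linarith) (fq_nonneg _ _))]
      have := fq_le_one (q := q - 1) (by linarith) hx
      nlinarith) hb ha
  simpa using this

lemma root_lip {c κ : ℝ} (hc : 0 < c) (hκ : 0 < κ) (hκ1 : κ ≤ 1) {a b : ℝ} (ha : c ≤ a) (hb : c ≤ b) :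
    |a ^ κ - b ^ κ| ≤ (κ * c ^ (κ - 1)) * |a - b| := by
  have := (convex_Ici c).norm_image_sub_le_of_norm_hasDerivWithin_le (f := fun x => x ^ κ)
    (f' := fun x => κ * x ^ (κ-1)) (C := κ * c ^ (κ - 1))
    (fun x hx => (Real.hasDerivAt_rpow_const (Or.inl (lt_of_lt_of_le hc hx).ne')).hasDerivWithinAt)
    (fun x hx => by
      rw [Real.norm_eq_abs, abs_of_nonneg (mul_nonneg hκ.le (Real.rpow_nonneg (hc.le.trans hx) _))]
      exact mul_le_mul_of_nonneg_left
        (Real.rpow_le_rpow_of_nonpos hc hx (by linarith)) hκ.le) hb ha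
  simpa using this

section ops
variable {N q β κ : ℝ}

lemma A_integrand_cont (hN : 1 ≤ N) (hq : 0 ≤ q) {w : ℝ → ℝ} (hw : Continuous w) (s : ℝ) :
    Continuous (fun u : ℝ => u ^ (N - 1) * fq q (w (s * u))) := by
  have h1 := Real.continuous_rpow_const (q := N - 1) (by linarith)
  have h2 := fq_cont hq
  fun_prop

lemma Aop_cont (hN : 1 ≤ N) (hq : 0 ≤ q) {w : ℝ → ℝ} (hw : Continuous w) :
    Continuous (Aop N q w) := by
  have h1 := Real.continuous_rpow_const (q := N - 1) (by linarith)
  have h2 := fq_cont hq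
  unfold Aop
  apply intervalIntegral.continuous_parametric_intervalIntegral_of_continuous'
  unfold Function.uncurry
  fun_prop

lemma Aop_nonneg (w : ℝ → ℝ) (s : ℝ) : 0 ≤ Aop N q w s := by
  apply intervalIntegral.integral_nonneg zero_le_one
  intro u hu
  exact mul_nonneg (Real.rpow_nonneg hu.1 _) (fq_nonneg _ _)

lemma Aop_le_one (hN : 1 ≤ N) (hq : 0 ≤ q) {w : ℝ → ℝ} (hw : Continuous w)
    (h1 : ∀ t, 0 ≤ t → w t ≤ 1) {s : ℝ} (hs : 0 ≤ s) : Aop N q w s ≤ 1 := by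
  have : Aop N q w s ≤ ∫ u in (0:ℝ)..1, (1:ℝ) := by
    apply intervalIntegral.integral_mono_on zero_le_one
      ((A_integrand_cont hN hq hw s).intervalIntegrable _ _) (by simp)
    intro u hu
    exact mul_le_one₀ (Real.rpow_le_one hu.1 hu.2 (by linarith)) (fq_nonneg _ _)
      (fq_le_one hq (h1 _ (mul_nonneg hs hu.1)))
  simpa using this

lemma Aop_lower (hN : 1 ≤ N) (hq : 0 ≤ q) {w : ℝ → ℝ} (hw : Continuous w)
    (h2 : ∀ t ∈ Icc (0:ℝ) (1/2), 1/2 ≤ w t) {T : ℝ} (hT : 1 ≤ T) {s : ℝ} (hs : s ∈ Icc 0 T) :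
    (∫ u in (0:ℝ)..(1/(2*T)), u ^ (N - 1) * (1/2:ℝ) ^ q) ≤ Aop N q w s := by
  have hT0 : 0 < 1 / (2*T) := by positivity
  have hT1 : 1 / (2*T) ≤ 1 := by rw [div_le_one (by positivity)]; linarith
  have hc := A_integrand_cont hN hq hw s
  have e : Aop N q w s = (∫ u in (0:ℝ)..(1/(2*T)), u ^ (N - 1) * fq q (w (s * u))) +
      ∫ u in (1/(2*T))..1, u ^ (N - 1) * fq q (w (s * u)) :=
    (intervalIntegral.integral_add_adjacent_intervals (hc.intervalIntegrable _ _)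
      (hc.intervalIntegrable _ _)).symm
  have p2 : 0 ≤ ∫ u in (1/(2*T))..1, u ^ (N - 1) * fq q (w (s * u)) := by
    apply intervalIntegral.integral_nonneg hT1
    intro u hu
    exact mul_nonneg (Real.rpow_nonneg (hT0.le.trans hu.1) _) (fq_nonneg _ _)
  have p1 : (∫ u in (0:ℝ)..(1/(2*T)), u ^ (N - 1) * (1/2:ℝ) ^ q) ≤
      (∫ u in (0:ℝ)..(1/(2*T)), u ^ (N - 1) * fq q (w (s * u))) := by
    apply intervalIntegral.integral_mono_on hT0.le
      (((Real.continuous_rpow_const (by linarith)).mul continuous_const).intervalIntegrable _ _)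
      (hc.intervalIntegrable _ _)
    intro u hu
    apply mul_le_mul_of_nonneg_left _ (Real.rpow_nonneg hu.1 _)
    have : s * u ≤ 1/2 := by
      calc s * u ≤ T * (1/(2*T)) := mul_le_mul hs.2 hu.2 hu.1 (by linarith)
        _ = 1/2 := by field_simp
    have h3 := h2 (s*u) ⟨mul_nonneg hs.1 hu.1, this⟩
    rw [fq_of_nonneg (by linarith)]
    exact Real.rpow_le_rpow (by norm_num) h3 hq
  linarith

lemma lower_pos (hN : 1 ≤ N) {T : ℝ} (hT : 1 ≤ T) :
    0 < ∫ u in (0:ℝ)..(1/(2*T)), u ^ (N - 1) * (1/2:ℝ) ^ q := by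
  have hT0 : 0 < 1 / (2*T) := by positivity
  apply intervalIntegral.intervalIntegral_pos_of_pos_on _ _ hT0
  · exact (((Real.continuous_rpow_const (by linarith)).mul continuous_const).intervalIntegrable _ _)
  · intro u hu
    have := hu.1
    positivity

lemma Aop_lip (hN : 1 ≤ N) (hq : 1 < q) {w v : ℝ → ℝ} (hw : Continuous w) (hv : Continuous v)
    (hw1 : ∀ t, 0 ≤ t → w t ≤ 1) (hv1 : ∀ t, 0 ≤ t → v t ≤ 1) {s D : ℝ} (hs : 0 ≤ s)
    (hD : ∀ t ∈ Icc 0 s, |w t - v t| ≤ D) : |Aop N q w s - Aop N q v s| ≤ q * D := by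
  unfold Aop
  rw [← intervalIntegral.integral_sub ((A_integrand_cont hN (by linarith) hw s).intervalIntegrable _ _)
    ((A_integrand_cont hN (by linarith) hv s).intervalIntegrable _ _)]
  have := intervalIntegral.norm_integral_le_of_norm_le_const (a := (0:ℝ)) (b := 1) (C := q * D)
    (f := fun u : ℝ => u ^ (N - 1) * fq q (w (s * u)) - u ^ (N - 1) * fq q (v (s * u))) (by
    intro u hu
    rw [uIoc_of_le zero_le_one] at hu
    have hsu : s * u ∈ Icc 0 s := ⟨mul_nonneg hs hu.1.le, by nlinarith [hu.2]⟩
    rw [← mul_sub, Real.norm_eq_abs, abs_mul, abs_of_nonneg (Real.rpow_nonneg hu.1.le _)]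
    have a1 : u ^ (N-1) ≤ 1 := Real.rpow_le_one hu.1.le hu.2 (by linarith)
    have a2 := fq_lip hq (hw1 _ hsu.1) (hv1 _ hsu.1)
    have a3 := hD _ hsu
    calc _ ≤ 1 * |fq q (w (s*u)) - fq q (v (s*u))| := by gcongr
      _ ≤ q * D := by rw [one_mul]; exact a2.trans (by gcongr))
  simpa using this

lemma T_integrand_cont (hN : 1 ≤ N) (hq : 0 ≤ q) (hβ : 0 ≤ β) (hκ : 0 ≤ κ)
    {w : ℝ → ℝ} (hw : Continuous w) :
    Continuous (fun s : ℝ => (max s 0) ^ β * (Aop N q w s) ^ κ) :=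
  (fq_cont hβ).mul ((Aop_cont hN hq hw).rpow_const (fun _ => Or.inr hκ))

lemma Tp_hasDerivAt (hN : 1 ≤ N) (hq : 0 ≤ q) (hβ : 0 ≤ β) (hκ : 0 ≤ κ)
    {w : ℝ → ℝ} (hw : Continuous w) (τ : ℝ) :
    HasDerivAt (Tp N q β κ w) (-((max τ 0) ^ β * (Aop N q w τ) ^ κ)) τ := by
  have hc := T_integrand_cont hN hq hβ hκ hw
  exact (intervalIntegral.integral_hasDerivAt_right (hc.intervalIntegrable _ _)
    (hc.stronglyMeasurableAtFilter _ _) hc.continuousAt).const_sub 1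

lemma Tp_cont (hN : 1 ≤ N) (hq : 0 ≤ q) (hβ : 0 ≤ β) (hκ : 0 ≤ κ)
    {w : ℝ → ℝ} (hw : Continuous w) : Continuous (Tp N q β κ w) :=
  continuous_iff_continuousAt.2 fun τ => (Tp_hasDerivAt hN hq hβ hκ hw τ).continuousAt

lemma Tp_neg (hβ : 0 < β) (w : ℝ → ℝ) {τ : ℝ} (hτ : τ ≤ 0) : Tp N q β κ w τ = 1 := by
  unfold Tp
  have : (∫ s in (0:ℝ)..τ, (max s 0) ^ β * (Aop N q w s) ^ κ) = ∫ s in (0:ℝ)..τ, (0:ℝ) := by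
    apply intervalIntegral.integral_congr
    intro s hs
    rw [uIcc_of_ge hτ] at hs
    simp only
    rw [max_eq_right hs.2, Real.zero_rpow hβ.ne', zero_mul]
  rw [this]; simp

lemma Tp_le_one (w : ℝ → ℝ) {τ : ℝ} (hτ : 0 ≤ τ) : Tp N q β κ w τ ≤ 1 := by
  unfold Tp
  have : 0 ≤ ∫ s in (0:ℝ)..τ, (max s 0) ^ β * (Aop N q w s) ^ κ := by
    apply intervalIntegral.integral_nonneg hτ
    intro s hs
    exact mul_nonneg (fq_nonneg _ _) (Real.rpow_nonneg (Aop_nonneg _ _) _)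
  linarith

lemma Tp_half (hN : 1 ≤ N) (hq : 0 ≤ q) (hβ : 0 ≤ β) (hκ : 0 ≤ κ)
    {w : ℝ → ℝ} (hw : Continuous w) (h1 : ∀ t, 0 ≤ t → w t ≤ 1) :
    ∀ t ∈ Icc (0:ℝ) (1/2), 1/2 ≤ Tp N q β κ w t := by
  intro t ht
  unfold Tp
  have : (∫ s in (0:ℝ)..t, (max s 0) ^ β * (Aop N q w s) ^ κ) ≤ ∫ s in (0:ℝ)..t, (1:ℝ) := by
    apply intervalIntegral.integral_mono_on ht.1
      ((T_integrand_cont hN hq hβ hκ hw).intervalIntegrable _ _) (by simp)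
    intro s hs
    exact mul_le_one₀ (fq_le_one hβ (by linarith [hs.2, ht.2])) (Real.rpow_nonneg (Aop_nonneg _ _) _)
      (Real.rpow_le_one (Aop_nonneg _ _) (Aop_le_one hN hq hw h1 hs.1) hκ)
  have h2 : (∫ s in (0:ℝ)..t, (1:ℝ)) = t := by simp
  linarith [ht.2]

/-- class of admissible functions -/
structure Adm (w : ℝ → ℝ) : Prop where
  cont : Continuous w
  le : ∀ t, 0 ≤ t → w t ≤ 1
  half : ∀ t ∈ Icc (0:ℝ) (1/2), 1/2 ≤ w t

lemma Adm_Top (hN : 1 ≤ N) (hq : 0 ≤ q) (hβ : 0 ≤ β) (hκ : 0 ≤ κ) {w : ℝ → ℝ} (hw : Adm w) :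
    Adm (Tp N q β κ w) :=
  ⟨Tp_cont hN hq hβ hκ hw.cont, fun _ ht => Tp_le_one _ ht, Tp_half hN hq hβ hκ hw.cont hw.le⟩

lemma contraction (hN : 1 ≤ N) (hq : 1 < q) (hβ : 0 ≤ β) (hκ : 0 < κ) (hκ1 : κ ≤ 1)
    {T : ℝ} (hT : 1 ≤ T) : ∃ l : ℝ, 0 < l ∧ ∀ w v : ℝ → ℝ, Adm w → Adm v → ∀ B : ℝ,
      (∀ t ∈ Icc 0 T, |w t - v t| ≤ B * exp (l * t)) →
      ∀ t ∈ Icc 0 T, |Tp N q β κ w t - Tp N q β κ v t| ≤ (B / 2) * exp (l * t) := by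
  set c := ∫ u in (0:ℝ)..(1/(2*T)), u ^ (N - 1) * (1/2:ℝ) ^ q with hc
  have hcpos : 0 < c := lower_pos hN hT
  set K := T ^ β * ((κ * c ^ (κ - 1)) * q) with hK
  have hKpos : 0 < K := by positivity
  refine ⟨2 * K, by positivity, ?_⟩
  intro w v hw hv B hB t ht
  have hB0 : 0 ≤ B := by
    have := (abs_nonneg _).trans (hB 0 ⟨le_rfl, by linarith⟩)
    simpa using this
  have iw := T_integrand_cont hN (by linarith) hβ hκ.le hw.cont (q := q)
  have iv := T_integrand_cont hN (by linarith) hβ hκ.le hv.cont (q := q)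
  have e : Tp N q β κ w t - Tp N q β κ v t = -∫ s in (0:ℝ)..t,
      ((max s 0) ^ β * (Aop N q w s) ^ κ - (max s 0) ^ β * (Aop N q v s) ^ κ) := by
    rw [intervalIntegral.integral_sub (iw.intervalIntegrable _ _) (iv.intervalIntegrable _ _)]
    unfold Tp; ring
  rw [e, abs_neg]
  have b : |∫ s in (0:ℝ)..t, ((max s 0) ^ β * (Aop N q w s) ^ κ - (max s 0) ^ β * (Aop N q v s) ^ κ)|
      ≤ ∫ s in (0:ℝ)..t, K * B * exp (2 * K * s) := by
    rw [← Real.norm_eq_abs]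
    apply intervalIntegral.norm_integral_le_of_norm_le ht.1
    · filter_upwards with s hs
      have hsT : s ∈ Icc 0 T := ⟨hs.1.le, hs.2.trans ht.2⟩
      rw [← mul_sub, Real.norm_eq_abs, abs_mul, max_eq_left hsT.1, abs_of_nonneg (Real.rpow_nonneg hsT.1 β)]
      have a1 : s ^ β ≤ T ^ β := Real.rpow_le_rpow hsT.1 hsT.2 hβ
      have a2 := root_lip hcpos hκ hκ1 (Aop_lower hN (by linarith) hw.cont hw.half hT hsT)
        (Aop_lower hN (by linarith) hv.cont hv.half hT hsT)
      have a3 := Aop_lip hN hq hw.cont hv.cont hw.le hv.le hsT.1 (D := B * exp (2 * K * s)) (by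
        intro r hr
        refine (hB r ⟨hr.1, hr.2.trans hsT.2⟩).trans ?_
        have := hr.2
        gcongr)
      calc _ ≤ T ^ β * ((κ * c ^ (κ - 1)) * (q * (B * exp (2 * K * s)))) := by
            gcongr
            exact a2.trans (by gcongr)
        _ = K * B * exp (2 * K * s) := by rw [hK]; ring
    · exact Continuous.intervalIntegrable (by fun_prop) _ _
  refine b.trans ?_
  have d : (∫ s in (0:ℝ)..t, K * B * exp (2 * K * s)) = (B/2) * exp (2 * K * t) - B/2 := by
    rw [intervalIntegral.integral_eq_sub_of_hasDerivAt (f := fun s => (B/2) * exp (2 * K * s))]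
    · simp
    · intro x _
      have := (((hasDerivAt_id x).const_mul (2*K)).exp).const_mul (B/2)
      refine this.congr_deriv ?_
      simp only [id]
      ring
    · exact Continuous.intervalIntegrable (by fun_prop) _ _
  rw [d]; linarith

lemma fixed_unique (hN : 1 ≤ N) (hq : 1 < q) (hβ : 0 ≤ β) (hκ : 0 < κ) (hκ1 : κ ≤ 1)
    {w v : ℝ → ℝ} (hw : Adm w) (hv : Adm v) (fw : ∀ t, 0 ≤ t → Tp N q β κ w t = w t)
    (fv : ∀ t, 0 ≤ t → Tp N q β κ v t = v t) : ∀ t, 0 ≤ t → w t = v t := by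
  intro t ht
  set T := max t 1
  obtain ⟨l, hl, H⟩ := contraction hN hq hβ hκ hκ1 (le_max_right t 1 : 1 ≤ T)
  obtain ⟨B, hB⟩ := isCompact_Icc.exists_bound_of_continuousOn (s := Icc 0 T)
    (hw.cont.sub hv.cont).continuousOn
  have hB0 : 0 ≤ B := (norm_nonneg _).trans (hB 0 ⟨le_rfl, by positivity⟩)
  have key : ∀ m : ℕ, ∀ t ∈ Icc 0 T, |w t - v t| ≤ (B / 2 ^ m) * exp (l * t) := by
    intro m
    induction m with
    | zero =>
      intro t ht
      have h1 := hB t ht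
      have h2 : 1 ≤ exp (l * t) := Real.one_le_exp (mul_nonneg hl.le ht.1)
      simp only [Real.norm_eq_abs] at h1
      simp only [pow_zero, div_one]
      exact h1.trans (by nlinarith)
    | succ m ih =>
      intro t ht
      have := H w v hw hv _ ih t ht
      rw [fw t ht.1, fv t ht.1] at this
      convert this using 2
      rw [pow_succ]; field_simp
  have lim : Tendsto (fun m : ℕ => (B / 2 ^ m) * exp (l * t)) atTop (nhds 0) := by
    have := ((tendsto_pow_atTop_nhds_zero_of_lt_one (r := (1/2:ℝ)) (by norm_num) (by norm_num)).const_mul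
      B).mul_const (exp (l*t))
    simp only [mul_zero, zero_mul] at this
    refine this.congr (fun m => ?_)
    rw [one_div, inv_pow]; rfl
  have := ge_of_tendsto' lim (fun m => key m t ⟨ht, le_max_left _ _⟩)
  exact sub_eq_zero.1 (abs_nonpos_iff.1 this)

lemma fixed_exists (hN : 1 ≤ N) (hq : 1 < q) (hβ : 0 < β) (hκ : 0 < κ) (hκ1 : κ ≤ 1) :
    ∃ w : ℝ → ℝ, Adm w ∧ ∀ t, Tp N q β κ w t = w t := by
  have hq0 : 0 ≤ q := by linarith
  let W : ℕ → ℝ → ℝ := fun m => (Tp N q β κ)^[m] (fun _ => 1)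
  have W0 : W 0 = fun _ => 1 := rfl
  have Ws : ∀ m, W (m+1) = Tp N q β κ (W m) := fun m => Function.iterate_succ_apply' _ _ _
  have WA : ∀ m, Adm (W m) := by
    intro m
    induction m with
    | zero => exact ⟨continuous_const, fun _ _ => le_rfl, fun _ _ => by rw [W0]; norm_num⟩
    | succ m ih => rw [Ws]; exact Adm_Top hN hq0 hβ.le hκ.le ih
  have Wneg : ∀ m, ∀ t ≤ 0, W m t = 1 := by
    intro m t ht
    cases m with
    | zero => rfl
    | succ m => rw [Ws]; exact Tp_neg hβ _ ht
  have step : ∀ T : ℝ, 1 ≤ T → ∃ l B : ℝ, 0 < l ∧ 0 ≤ B ∧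
      (∀ w v : ℝ → ℝ, Adm w → Adm v → ∀ B : ℝ,
      (∀ t ∈ Icc 0 T, |w t - v t| ≤ B * exp (l * t)) →
      ∀ t ∈ Icc 0 T, |Tp N q β κ w t - Tp N q β κ v t| ≤ (B / 2) * exp (l * t)) ∧
      ∀ m : ℕ, ∀ t ∈ Icc 0 T, |W m t - W (m+1) t| ≤ (B / 2 ^ m) * exp (l * t) := by
    intro T hT
    obtain ⟨l, hl, H⟩ := contraction hN hq hβ.le hκ hκ1 hT
    obtain ⟨B, hB⟩ := isCompact_Icc.exists_bound_of_continuousOn (s := Icc 0 T)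
      ((WA 0).cont.sub (WA 1).cont).continuousOn
    have hB0 : 0 ≤ B := (norm_nonneg _).trans (hB 0 ⟨le_rfl, by positivity⟩)
    refine ⟨l, B, hl, hB0, H, ?_⟩
    intro m
    induction m with
    | zero =>
      intro t ht
      have h1 := hB t ht
      have h2 : 1 ≤ exp (l * t) := Real.one_le_exp (mul_nonneg hl.le ht.1)
      simp only [Real.norm_eq_abs] at h1
      simp only [pow_zero, div_one]
      exact h1.trans (by nlinarith)
    | succ m ih =>
      intro t ht
      have := H _ _ (WA m) (WA (m+1)) _ ih t ht
      rw [← Ws, ← Ws] at this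
      convert this using 2
      rw [pow_succ]; field_simp
  have conv : ∀ t, ∃ y, Tendsto (fun m => W m t) atTop (nhds y) := by
    intro t
    rcases le_total t 0 with ht | ht
    · exact ⟨1, tendsto_const_nhds.congr (fun m => (Wneg m t ht).symm)⟩
    · obtain ⟨l, B, hl, hB0, -, h⟩ := step (max t 1) (le_max_right _ _)
      apply cauchySeq_tendsto_of_complete
      apply cauchySeq_of_le_geometric_two (C := 2 * (B * exp (l * t)))
      intro m
      rw [Real.dist_eq]
      refine (h m t ⟨ht, le_max_left _ _⟩).trans (le_of_eq ?_)
      ring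
  choose w hw using conv
  have wneg : ∀ t ≤ 0, w t = 1 := fun t ht =>
    tendsto_nhds_unique (hw t) (tendsto_const_nhds.congr (fun m => (Wneg m t ht).symm))
  have est : ∀ T : ℝ, 1 ≤ T → ∃ l B : ℝ, 0 < l ∧ 0 ≤ B ∧
      (∀ w v : ℝ → ℝ, Adm w → Adm v → ∀ B : ℝ,
      (∀ t ∈ Icc 0 T, |w t - v t| ≤ B * exp (l * t)) →
      ∀ t ∈ Icc 0 T, |Tp N q β κ w t - Tp N q β κ v t| ≤ (B / 2) * exp (l * t)) ∧
      ∀ m : ℕ, ∀ t ∈ Icc 0 T, |W m t - w t| ≤ (2 * B / 2 ^ m) * exp (l * t) := by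
    intro T hT
    obtain ⟨l, B, hl, hB0, H, h⟩ := step T hT
    refine ⟨l, B, hl, hB0, H, ?_⟩
    intro m t ht
    have := dist_le_of_le_geometric_two_of_tendsto (C := 2 * (B * exp (l * t)))
      (f := fun m => W m t) (fun m => by
      rw [Real.dist_eq]
      refine (h m t ht).trans (le_of_eq ?_)
      ring) (hw t) m
    rw [Real.dist_eq] at this
    refine this.trans (le_of_eq ?_)
    ring
  have lim0 : ∀ C : ℝ, Tendsto (fun m : ℕ => C / 2 ^ m) atTop (nhds 0) := by
    intro C
    have := ((tendsto_pow_atTop_nhds_zero_of_lt_one (r := (1/2:ℝ)) (by norm_num) (by norm_num)).const_mul C)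
    simp only [mul_zero] at this
    refine this.congr (fun m => ?_)
    rw [one_div, inv_pow]; rfl
  have wc : Continuous w := by
    have : TendstoLocallyUniformly W w atTop := by
      rw [Metric.tendstoLocallyUniformly_iff]
      intro ε hε x
      set T := max (x+1) 1
      obtain ⟨l, B, hl, hB0, -, h⟩ := est T (le_max_right _ _)
      refine ⟨Iio T, Iio_mem_nhds (lt_of_lt_of_le (by linarith) (le_max_left _ _)), ?_⟩
      have := (lim0 (2 * B * exp (l * T))).eventually (gt_mem_nhds hε)
      filter_upwards [this] with m hm y hy
      rw [dist_comm, Real.dist_eq]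
      rcases le_total y 0 with h0 | h0
      · rw [Wneg m y h0, wneg y h0]; simpa using hε
      · refine lt_of_le_of_lt ((h m y ⟨h0, le_of_lt hy⟩).trans ?_) hm
        have hy' : y ≤ T := le_of_lt hy
        calc _ ≤ (2 * B / 2 ^ m) * exp (l * T) := by gcongr
          _ = _ := by ring
    exact this.continuous (Frequently.of_forall fun m => (WA m).cont)
  have wA : Adm w := ⟨wc, fun t ht => le_of_tendsto' (hw t) (fun m => (WA m).le t ht),
    fun t ht => ge_of_tendsto' (hw t) (fun m => (WA m).half t ht)⟩
  refine ⟨w, wA, fun t => ?_⟩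
  rcases le_total t 0 with ht | ht
  · rw [wneg t ht, Tp_neg hβ _ ht]
  · obtain ⟨l, B, hl, hB0, H, h⟩ := est (max t 1) (le_max_right _ _)
    have h1 : Tendsto (fun m => W (m+1) t) atTop (nhds (Tp N q β κ w t)) := by
      rw [tendsto_iff_dist_tendsto_zero]
      refine squeeze_zero (fun _ => dist_nonneg) (fun m => ?_) (lim0 (B * exp (l * t)))
      rw [Real.dist_eq, Ws]
      refine (H _ _ (WA m) wA _ (h m) t ⟨ht, le_max_left _ _⟩).trans (le_of_eq ?_)
      ring
    exact tendsto_nhds_unique h1 ((tendsto_add_atTop_iff_nat 1).2 (hw t))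

end ops
lemma mono_of {a : ℝ} {f d : ℝ → ℝ} (hf : ContinuousOn f (Ici a))
    (df : ∀ x, a < x → HasDerivAt f (d x) x) (hd : ∀ x, a < x → 0 ≤ d x) : MonotoneOn f (Ici a) := by
  apply monotoneOn_of_deriv_nonneg (convex_Ici a) hf
  · intro x hx
    rw [interior_Ici] at hx
    exact (df x hx).differentiableAt.differentiableWithinAt
  · intro x hx
    rw [interior_Ici] at hx
    rw [(df x hx).deriv]; exact hd x hx

lemma eq_Ici {f g d : ℝ → ℝ} (hf : ContinuousOn f (Ici 0)) (hg : ContinuousOn g (Ici 0))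
    (h0 : f 0 = g 0) (df : ∀ x, 0 < x → HasDerivAt f (d x) x)
    (dg : ∀ x, 0 < x → HasDerivAt g (d x) x) : ∀ x, 0 ≤ x → f x = g x := by
  intro x hx
  have m1 := mono_of (hf.sub hg) (fun x hx => (df x hx).sub (dg x hx)) (fun x _ => by simp)
    (mem_Ici.2 le_rfl) (mem_Ici.2 hx) hx
  have m2 := mono_of (hg.sub hf) (fun x hx => (dg x hx).sub (df x hx)) (fun x _ => by simp)
    (mem_Ici.2 le_rfl) (mem_Ici.2 hx) hx
  simp only [Pi.sub_apply] at m1 m2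
  linarith

section poho
variable {N q : ℝ}

def Yop (N q : ℝ) (w : ℝ → ℝ) (τ : ℝ) : ℝ := ∫ t in (0:ℝ)..τ, (max t 0) ^ (N - 1) * fq q (w t)

lemma Y_integrand_cont (hN : 1 ≤ N) (hq : 0 ≤ q) {w : ℝ → ℝ} (hw : Continuous w) :
    Continuous (fun t : ℝ => (max t 0) ^ (N - 1) * fq q (w t)) :=
  (fq_cont (q := N - 1) (by linarith)).mul ((fq_cont hq).comp hw)

lemma Yop_hasDerivAt (hN : 1 ≤ N) (hq : 0 ≤ q) {w : ℝ → ℝ} (hw : Continuous w) (τ : ℝ) :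
    HasDerivAt (Yop N q w) ((max τ 0) ^ (N - 1) * fq q (w τ)) τ := by
  have hc := Y_integrand_cont hN hq hw
  exact (intervalIntegral.integral_hasDerivAt_right (hc.intervalIntegrable _ _)
    (hc.stronglyMeasurableAtFilter _ _) hc.continuousAt)

lemma Yop_zero (w : ℝ → ℝ) : Yop N q w 0 = 0 := by simp [Yop]

lemma Yop_eq (w : ℝ → ℝ) {τ : ℝ} (hτ : 0 < τ) : Yop N q w τ = τ ^ N * Aop N q w τ := by
  have h := intervalIntegral.mul_integral_comp_mul_left (a := 0) (b := 1) (c := τ)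
    (f := fun t : ℝ => (max t 0) ^ (N - 1) * fq q (w t))
  rw [mul_zero, mul_one] at h
  unfold Yop Aop
  rw [← h]
  have e : (∫ u in (0:ℝ)..1, (max (τ * u) 0) ^ (N - 1) * fq q (w (τ * u))) =
      ∫ u in (0:ℝ)..1, τ ^ (N-1) * (u ^ (N - 1) * fq q (w (τ * u))) := by
    apply intervalIntegral.integral_congr
    intro u hu
    rw [uIcc_of_le zero_le_one] at hu
    simp only
    rw [max_eq_left (mul_nonneg hτ.le hu.1), Real.mul_rpow hτ.le hu.1, mul_assoc]
  rw [e, intervalIntegral.integral_const_mul, ← mul_assoc, Real.rpow_sub_one hτ.ne']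
  congr 1
  field_simp

lemma Aop_pos (hN : 1 ≤ N) (hq : 0 ≤ q) {w : ℝ → ℝ} (hw : Adm w) {s : ℝ} (hs : 0 ≤ s) :
    0 < Aop N q w s :=
  (lower_pos hN (le_max_right s 1)).trans_le
    (Aop_lower hN hq hw.cont hw.half (le_max_right s 1) ⟨hs, le_max_left _ _⟩)

lemma fq_mul (hq : 0 < q) (x : ℝ) : fq q x * x = fq (q+1) x := by
  rcases le_total x 0 with h | h
  · unfold fq
    rw [max_eq_right h, Real.zero_rpow hq.ne', Real.zero_rpow (by linarith), zero_mul]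
  · rw [fq_of_nonneg h, fq_of_nonneg h, Real.rpow_add_one' h (by linarith)]

lemma fixed_pos {n κ σ : ℝ} (hN : 1 ≤ n + σ) (hq : 1 < q) (hσ : 0 ≤ σ) (hκ : 0 < κ)
    (hc0 : 0 ≤ (n * κ - 2) / (1 + κ)) (hc : (n + σ) / (q + 1) ≤ (n * κ - 2) / (1 + κ))
    {w : ℝ → ℝ} (hw : Adm w) (fw : ∀ t, Tp (n+σ) q (1 + σ * κ) κ w t = w t) :
    ∀ t, 0 ≤ t → 0 < w t := by
  intro R hR0
  by_contra! hR
  have hβ : 0 < 1 + σ * κ := by positivity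
  have w0 : w 0 = 1 := by rw [← fw, Tp_neg hβ _ le_rfl]
  have hRpos : 0 < R := by
    rcases hR0.eq_or_lt with h | h
    · rw [← h, w0] at hR; linarith
    · exact h
  have hq0 : 0 ≤ q := by linarith
  obtain ⟨N, hNdef⟩ : ∃ N, N = n + σ := ⟨_, rfl⟩
  obtain ⟨c, hcdef⟩ : ∃ c, c = (n * κ - 2) / (1 + κ) := ⟨_, rfl⟩
  rw [← hcdef] at hc hc0
  rw [← hNdef] at hc hN fw
  have hA := Aop_cont hN hq0 hw.cont
  have hYc : Continuous (Yop N q w) :=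
    continuous_iff_continuousAt.2 fun τ => (Yop_hasDerivAt hN hq0 hw.cont τ).continuousAt
  let P : ℝ → ℝ := fun τ => (1/(1+κ)) * (τ ^ (2 + N + σ * κ) * (Aop N q w τ) ^ (1 + κ)) +
    τ ^ N * fq (q+1) (w τ) / (q+1) - c * (Yop N q w τ * w τ)
  have hexp : 0 < 2 + N + σ * κ := by positivity
  have hPc : Continuous P := by
    have h1 := Real.continuous_rpow_const (q := 2 + N + σ * κ) hexp.le
    have h2 := Real.continuous_rpow_const (q := N) (by linarith)
    have h3 : Continuous fun τ => (Aop N q w τ) ^ (1 + κ) := hA.rpow_const (fun _ => Or.inr (by linarith))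
    have h4 : Continuous (fq (q+1)) := fq_cont (by linarith)
    have h5 := hw.cont
    exact ((continuous_const.mul (h1.mul h3)).add ((h2.mul (h4.comp h5)).div_const _)).sub
      (continuous_const.mul (hYc.mul h5))
  have hP0 : P 0 = 0 := by
    simp only [P]
    rw [Yop_zero, Real.zero_rpow hexp.ne', Real.zero_rpow (by linarith)]
    ring
  have hPR : 0 < P R := by
    have a1 : 0 < Aop N q w R := Aop_pos hN hq0 hw hR0
    have a2 : fq (q+1) (w R) = 0 := by
      unfold fq; rw [max_eq_right hR, Real.zero_rpow (by linarith)]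
    have a3 : 0 < Yop N q w R := by rw [Yop_eq w hRpos]; positivity
    have a4 : 0 < (1/(1+κ)) * (R ^ (2 + N + σ * κ) * (Aop N q w R) ^ (1 + κ)) := by positivity
    have a5 : c * (Yop N q w R * w R) ≤ 0 :=
      mul_nonpos_of_nonneg_of_nonpos hc0 (mul_nonpos_of_nonneg_of_nonpos a3.le hR)
    simp only [P]
    rw [a2, mul_zero, zero_div]
    linarith
  have hder : ∀ τ, 0 < τ → HasDerivAt P ((N/(q+1) - c) * (τ ^ (N-1) * fq (q+1) (w τ))) τ := by
    intro τ hτ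
    have hY : ∀ s, 0 < s → 0 < Yop N q w s := fun s hs => by
      rw [Yop_eq w hs]; exact mul_pos (by positivity) (Aop_pos hN hq0 hw hs.le)
    have dw : HasDerivAt w (-(τ ^ (1 - n * κ) * (Yop N q w τ) ^ κ)) τ := by
      have h := Tp_hasDerivAt hN hq0 hβ.le hκ.le hw.cont τ
      rw [funext fw] at h
      convert h using 2
      rw [max_eq_left hτ.le, Yop_eq w hτ, Real.mul_rpow (by positivity) (Aop_nonneg _ _), ← mul_assoc,
        ← Real.rpow_mul hτ.le, ← Real.rpow_add hτ]
      congr 2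
      rw [hNdef]; ring
    have dY := Yop_hasDerivAt hN hq0 hw.cont τ
    rw [max_eq_left hτ.le] at dY
    have dF := (fq_hasDerivAt (q := q+1) (by linarith) (w τ)).comp τ dw
    rw [add_sub_cancel_right] at dF
    have d1 := (Real.hasDerivAt_rpow_const (x := τ) (p := 2 - n * κ) (Or.inl hτ.ne')).mul
      (dY.rpow_const (p := 1 + κ) (Or.inl (hY τ hτ).ne'))
    have d2 := ((Real.hasDerivAt_rpow_const (x := τ) (p := N) (Or.inl hτ.ne')).mul dF).div_const (q+1)
    have d3 := (dY.mul dw).const_mul c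
    have d := ((d1.const_mul (1/(1+κ))).add d2).sub d3
    have ev : P =ᶠ[nhds τ] (fun τ => (1/(1+κ)) * (τ ^ (2 - n * κ) * (Yop N q w τ) ^ (1 + κ)) +
        τ ^ N * fq (q+1) (w τ) / (q+1) - c * (Yop N q w τ * w τ)) := by
      filter_upwards [Ioi_mem_nhds hτ] with s hs
      have hs' : 0 < s := hs
      simp only [P]
      have : s ^ (2 + N + σ * κ) * (Aop N q w s) ^ (1 + κ) =
          s ^ (2 - n * κ) * (Yop N q w s) ^ (1 + κ) := by
        rw [Yop_eq w hs', Real.mul_rpow (by positivity) (Aop_nonneg _ _), ← mul_assoc,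
          ← Real.rpow_mul hs'.le, ← Real.rpow_add hs']
        congr 2
        rw [hNdef]; ring
      rw [this]
    refine HasDerivAt.congr_of_eventuallyEq ?_ ev
    refine d.congr_deriv ?_
    have y0 := hY τ hτ
    have e1 : (2 - n * κ - 1) = 1 - n * κ := by ring
    have e2 : τ ^ (2 - n * κ) = τ * τ ^ (1 - n * κ) := by
      rw [← e1, Real.rpow_sub_one hτ.ne']; field_simp
    have e3 : (Yop N q w τ) ^ (1 + κ) = Yop N q w τ * (Yop N q w τ) ^ κ := by
      rw [Real.rpow_add y0, Real.rpow_one]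
    have e4 : (1 + κ - 1) = κ := by ring
    have e5 : τ ^ N = τ * τ ^ (N - 1) := by rw [Real.rpow_sub_one hτ.ne']; field_simp
    simp only [Function.comp]
    rw [e1, e4, e2, e3, e5, ← fq_mul (by linarith) (w τ), hcdef]
    field_simp
    ring
  have mono := mono_of (a := 0) (f := fun τ => - P τ) hPc.neg.continuousOn (fun x hx => (hder x hx).neg)
    (fun x hx => by
      have : (N/(q+1) - c) ≤ 0 := by linarith
      have h2 : 0 ≤ (x ^ (N-1) * fq (q+1) (w x)) := mul_nonneg (Real.rpow_nonneg hx.le _) (fq_nonneg _ _)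
      nlinarith) (mem_Ici.2 le_rfl) (mem_Ici.2 hR0) hR0
  simp only at mono
  linarith

end poho
lemma blowup {n k : ℕ} (hk : 1 ≤ k) (hn : 2 * k < n) {q σ : ℝ} (hq : (k : ℝ) < q) (hσ : 0 ≤ σ)
    {w p y : ℝ → ℝ} (hw : ∀ t, 0 ≤ t → 0 < w t) (hwc : ContinuousOn w (Ici 0))
    (dw : ∀ t, 0 < t → HasDerivAt w (p t) t) (hp : ∀ t, 0 < t → 0 < p t)
    (dp : ∀ t, 0 < t → DifferentiableAt ℝ p t)
    (hyc : ContinuousOn y (Ici 0)) (hy0 : y 0 = 0)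
    (hy : ∀ t, 0 < t → y t = t ^ ((n:ℝ) - k) * p t ^ k)
    (dy : ∀ t, 0 < t → HasDerivAt y (t ^ ((n:ℝ) - 1 + σ) * w t ^ q) t) : False := by
  have hk1 : (1:ℝ) ≤ k := by exact_mod_cast hk
  have hn1 : 2 * (k:ℝ) < n := by exact_mod_cast hn
  obtain ⟨N, hN⟩ : ∃ N, N = (n:ℝ) + σ := ⟨_, rfl⟩
  have hNpos : 0 < N := by linarith
  have hN1 : (n:ℝ) - 1 + σ = N - 1 := by rw [hN]; ring
  rw [hN1] at dy
  -- upper bound on y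
  have yle : ∀ t, 0 < t → y t ≤ t ^ N * w t ^ q / N := by
    intro t ht
    have m := mono_of (a := 0) (f := fun t => t ^ N * w t ^ q / N - y t)
      (d := fun t => t ^ N * (p t * q * w t ^ (q-1)) / N) (by
        have h1 : ContinuousOn (fun t : ℝ => t ^ N) (Ici 0) :=
          (Real.continuous_rpow_const hNpos.le).continuousOn
        have h2 : ContinuousOn (fun t : ℝ => w t ^ q) (Ici 0) :=
          hwc.rpow_const (fun t ht => Or.inl (hw t ht).ne')
        exact ((h1.mul h2).div_const N).sub hyc)
      (fun t ht => by
        have d1 := ((Real.hasDerivAt_rpow_const (x := t) (p := N) (Or.inl ht.ne')).mul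
          ((dw t ht).rpow_const (p := q) (Or.inl (hw t ht.le).ne'))).div_const N
        refine (d1.sub (dy t ht)).congr_deriv ?_
        field_simp
        ring)
      (fun t ht => by
        have := hp t ht
        have := hw t ht.le
        have : 0 < q := by linarith
        positivity) (mem_Ici.2 le_rfl) (mem_Ici.2 ht.le) ht.le
    simp only at m
    rw [hy0, Real.zero_rpow hNpos.ne'] at m
    simp only [zero_mul, zero_div, sub_zero] at m
    linarith
  obtain ⟨c0, hc0⟩ : ∃ c0, c0 = (k + σ) / N := ⟨_, rfl⟩
  have hc0pos : 0 < c0 := by rw [hc0]; positivity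
  have pder : ∀ t, 1 ≤ t → c0 * w t ^ q ≤ k * p t ^ (k-1) * deriv p t := by
    intro t ht1
    have ht : 0 < t := by linarith
    have d1 := (Real.hasDerivAt_rpow_const (x := t) (p := (n:ℝ) - k) (Or.inl ht.ne')).mul
      ((dp t ht).hasDerivAt.pow k)
    have ev : y =ᶠ[nhds t] ((fun x : ℝ => x ^ ((n:ℝ) - k)) * (p ^ k)) := by
      filter_upwards [Ioi_mem_nhds ht] with s hs
      exact hy s hs
    have e := (dy t ht).unique (d1.congr_of_eventuallyEq ev)
    have e1 : t ^ (N - 1) * t = t ^ N := by rw [Real.rpow_sub_one ht.ne']; field_simp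
    have e2 : t ^ ((n:ℝ) - k - 1) * t = t ^ ((n:ℝ) - k) := by
      rw [Real.rpow_sub_one ht.ne']; field_simp
    have h1 := yle t ht
    rw [hy t ht] at h1
    simp only [Pi.pow_apply] at e
    obtain ⟨a, ha⟩ : ∃ a, a = t ^ ((n:ℝ) - k) := ⟨_, rfl⟩
    have hapos : 0 < a := by rw [ha]; positivity
    obtain ⟨D, hD⟩ : ∃ D, D = (k:ℝ) * p t ^ (k-1) * deriv p t := ⟨_, rfl⟩
    have e3 : t ^ N * w t ^ q = ((n:ℝ) - k) * a * p t ^ k + a * t * D := by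
      rw [← e1, mul_right_comm, e, ha, ← e2, hD]; ring
    have e4 : t ^ N = a * t * t ^ (k + σ - 1) := by
      have : N = ((n:ℝ) - k) + 1 + (k + σ - 1) := by rw [hN]; ring
      rw [this, Real.rpow_add ht, Real.rpow_add ht, Real.rpow_one, ha]
    have e5 : 1 ≤ t ^ (k + σ - 1) := Real.one_le_rpow ht1 (by linarith)
    have wq : 0 < w t ^ q := Real.rpow_pos_of_pos (hw t ht.le) _
    rw [← ha] at h1
    have e6 : c0 * (t ^ N * w t ^ q) ≤ a * t * D := by
      have h2 : ((n:ℝ) - k) * (a * p t ^ k) ≤ ((n:ℝ) - k) * (t ^ N * w t ^ q / N) :=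
        mul_le_mul_of_nonneg_left h1 (by linarith)
      have h3 : c0 * (t ^ N * w t ^ q) = t ^ N * w t ^ q - ((n:ℝ) - k) * (t ^ N * w t ^ q / N) := by
        rw [hc0]; field_simp; rw [hN]; ring
      rw [h3]; linarith
    rw [← hD]
    have hat : 0 < a * t := by positivity
    have e7 : a * t * (c0 * w t ^ q) ≤ a * t * D := by
      refine le_trans ?_ e6
      rw [e4]
      have : 0 < a * t * (c0 * w t ^ q) := by positivity
      nlinarith
    exact le_of_mul_le_mul_left e7 hat
  have hq1 : 0 < q + 1 := by linarith
  obtain ⟨c1, hc1⟩ : ∃ c1, c1 = min (c0 / (q+1)) (p 1 ^ (k+1) / w 1 ^ (q+1)) := ⟨_, rfl⟩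
  have p1 := hp 1 one_pos
  have w1 := hw 1 zero_le_one
  have hc1pos : 0 < c1 := by rw [hc1]; positivity
  have E : ∀ t, 1 ≤ t → c1 * w t ^ (q+1) ≤ p t ^ (k+1) := by
    intro t ht1
    have dE : ∀ t, 1 ≤ t → HasDerivAt (fun t => p t ^ (k+1) - c1 * w t ^ (q+1))
        ((k+1) * p t ^ k * deriv p t - c1 * (p t * (q+1) * w t ^ q)) t := by
      intro t ht
      have ht0 : 0 < t := by linarith
      have d1 := (dp t ht0).hasDerivAt.pow (k+1)
      have d2 := ((dw t ht0).rpow_const (p := q+1) (Or.inl (hw t ht0.le).ne')).const_mul c1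
      refine (d1.sub d2).congr_deriv ?_
      simp
    have m := mono_of (a := 1) (f := fun t => p t ^ (k+1) - c1 * w t ^ (q+1))
      (fun t ht => (dE t ht).continuousAt.continuousWithinAt) (fun t ht => dE t ht.le)
      (fun t ht => by
        have ht0 : 0 < t := by linarith
        have h1 := pder t ht.le
        have h2 : c1 * (q+1) ≤ c0 := by
          have : c1 ≤ c0 / (q+1) := by rw [hc1]; exact min_le_left _ _
          rwa [le_div_iff₀ hq1] at this
        have hpt := hp t ht0
        have wq : 0 < w t ^ q := Real.rpow_pos_of_pos (hw t ht0.le) _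
        have e : p t ^ k = p t ^ (k-1) * p t := by rw [← pow_succ, Nat.sub_add_cancel hk]
        have h3 : c0 * w t ^ q * p t ≤ k * p t ^ k * deriv p t := by
          rw [e]; nlinarith
        have h4 : 0 < c0 * w t ^ q * p t := by positivity
        have h5 : 0 ≤ p t ^ k * deriv p t := by
          by_contra! hneg
          nlinarith
        have h6 : c1 * (q+1) * (w t ^ q * p t) ≤ c0 * (w t ^ q * p t) :=
          mul_le_mul_of_nonneg_right h2 (by positivity)
        nlinarith) (mem_Ici.2 le_rfl) (mem_Ici.2 ht1) ht1
    simp only at m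
    have : c1 * w 1 ^ (q+1) ≤ p 1 ^ (k+1) := by
      have : c1 ≤ p 1 ^ (k+1) / w 1 ^ (q+1) := by rw [hc1]; exact min_le_right _ _
      rwa [le_div_iff₀ (by positivity)] at this
    linarith
  obtain ⟨ε, hε⟩ : ∃ ε : ℝ, ε = (q - k) / (k + 1) := ⟨_, rfl⟩
  have hεpos : 0 < ε := by rw [hε]; exact div_pos (by linarith) (by linarith)
  obtain ⟨c2, hc2⟩ : ∃ c2 : ℝ, c2 = c1 ^ ((1:ℝ)/(k+1)) := ⟨_, rfl⟩
  have hc2pos : 0 < c2 := by rw [hc2]; positivity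
  have F : ∀ t, 1 ≤ t → c2 * w t ^ (1 + ε) ≤ p t := by
    intro t ht
    have ht0 : 0 < t := by linarith
    have hpt := hp t ht0
    have hwt := hw t ht0.le
    refine le_of_pow_le_pow_left₀ (n := k+1) (by omega) hpt.le ?_
    refine le_trans (le_of_eq ?_) (E t ht)
    rw [mul_pow, hc2, ← Real.rpow_natCast, ← Real.rpow_natCast, ← Real.rpow_mul hc1pos.le,
      ← Real.rpow_mul hwt.le]
    have a1 : (1:ℝ)/(k+1) * ((k+1 : ℕ) : ℝ) = 1 := by push_cast; field_simp
    have a2 : (1 + ε) * ((k+1 : ℕ) : ℝ) = q + 1 := by rw [hε]; push_cast; field_simp; ring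
    rw [a1, a2, Real.rpow_one]
  have G : ∀ t, 1 ≤ t → ε * c2 * t ≤ w 1 ^ (-ε) + ε * c2 := by
    intro t ht
    have dG : ∀ t, 1 ≤ t → HasDerivAt (fun t => - (w t ^ (-ε)) - ε * c2 * t)
        (ε * (w t ^ (-ε - 1) * p t - c2)) t := by
      intro t ht
      have ht0 : 0 < t := by linarith
      have d1 := ((dw t ht0).rpow_const (p := -ε) (Or.inl (hw t ht0.le).ne')).neg
      have d2 := (hasDerivAt_id t).const_mul (ε * c2)
      refine (d1.sub d2).congr_deriv ?_
      ring
    have m := mono_of (a := 1) (f := fun t => - (w t ^ (-ε)) - ε * c2 * t)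
      (fun t ht => (dG t ht).continuousAt.continuousWithinAt) (fun t ht => dG t ht.le)
      (fun t ht => by
        have ht0 : 0 < t := by linarith
        have hwt := hw t ht0.le
        have h1 := F t ht.le
        have h2 : w t ^ (-ε - 1) * w t ^ (1 + ε) = 1 := by
          rw [← Real.rpow_add hwt]
          have : -ε - 1 + (1 + ε) = 0 := by ring
          rw [this, Real.rpow_zero]
        have h3 : 0 < w t ^ (-ε - 1) := by positivity
        have h4 := mul_le_mul_of_nonneg_left h1 h3.le
        have h5 : w t ^ (-ε - 1) * (c2 * w t ^ (1 + ε)) = c2 := by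
          rw [mul_left_comm, h2, mul_one]
        exact mul_nonneg hεpos.le (by linarith))
      (mem_Ici.2 le_rfl) (mem_Ici.2 ht) ht
    simp only at m
    have : 0 < w t ^ (-ε) := Real.rpow_pos_of_pos (hw t (by linarith)) _
    linarith
  have hec : 0 < ε * c2 := by positivity
  have hw1e : 0 < w 1 ^ (-ε) := by positivity
  have := G (w 1 ^ (-ε) / (ε * c2) + 2) (by
    have : 0 < w 1 ^ (-ε) / (ε * c2) := by positivity
    linarith)
  rw [mul_add, mul_div_cancel₀ _ hec.ne'] at this
  linarith

section main
variable {n k : ℕ} {q σ : ℝ}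

lemma uniq_aux (hk : 1 ≤ k) (hn : 2 * k < n) (hq : (k : ℝ) < q) (hσ : 0 ≤ σ) {v : ℝ → ℝ}
    (hv : IsIVPSol n k q σ v) : ∃ w : ℝ → ℝ, Adm w ∧ (∀ t, 0 ≤ t → w t = - v t) ∧
      ∀ t, 0 ≤ t → Tp (n + σ) q (1 + σ * (1/k)) (1/k) w t = w t := by
  obtain ⟨hv2, hv1, hv0, -, hvneg, hode⟩ := hv
  have hk1 : (1:ℝ) ≤ k := by exact_mod_cast hk
  have hk0 : (0:ℝ) < k := by linarith
  have hn1 : 2 * (k:ℝ) < n := by exact_mod_cast hn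
  have hN : 1 ≤ (n:ℝ) + σ := by linarith
  have hq0 : 0 ≤ q := by linarith
  have hκ : 0 < 1 / (k:ℝ) := by positivity
  have hβ : 0 < 1 + σ * (1/(k:ℝ)) := by positivity
  have dv : ∀ t, 0 < t → HasDerivAt v (deriv v t) t := fun t ht =>
    ((hv2.differentiableOn (by norm_num)).differentiableAt (Ioi_mem_nhds ht)).hasDerivAt
  have ddv : ContDiffOn ℝ 1 (deriv v) (Ioi 0) := by
    have := (contDiffOn_succ_iff_deriv_of_isOpen (n := 1) isOpen_Ioi).1
      (by simpa [one_add_one_eq_two] using hv2)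
    exact this.2.2
  have dp : ∀ t, 0 < t → DifferentiableAt ℝ (deriv v) t := fun t ht =>
    (ddv.differentiableOn (by norm_num)).differentiableAt (Ioi_mem_nhds ht)
  have hvc : ContinuousOn v (Ici 0) := hv1.continuousOn
  have hpc : ContinuousOn (derivWithin v (Ici 0)) (Ici 0) :=
    hv1.continuousOn_derivWithin (uniqueDiffOn_Ici 0) le_rfl
  have hpe : ∀ t, 0 < t → derivWithin v (Ici 0) t = deriv v t := fun t ht =>
    derivWithin_of_mem_nhds (Ici_mem_nhds ht)
  let y : ℝ → ℝ := fun t => t ^ ((n:ℝ) - k) * derivWithin v (Ici 0) t ^ k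
  have hyc : ContinuousOn y (Ici 0) :=
    (Real.continuous_rpow_const (by linarith)).continuousOn.mul (hpc.pow k)
  have hy0 : y 0 = 0 := by
    simp only [y]; rw [Real.zero_rpow (by linarith), zero_mul]
  have hye : ∀ t, 0 < t → y t = t ^ ((n:ℝ) - k) * deriv v t ^ k := fun t ht => by
    simp only [y]; rw [hpe t ht]
  have dpos : ∀ t, 0 < t → 0 < t ^ ((n:ℝ) - 1 + σ) * (- v t) ^ q := fun t ht => by
    have := hvneg t ht.le
    exact mul_pos (by positivity) (Real.rpow_pos_of_pos (by linarith) _)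
  have dy : ∀ t, 0 < t → HasDerivAt y (t ^ ((n:ℝ) - 1 + σ) * (- v t) ^ q) t := by
    intro t ht
    have h := hode t ht
    have hd : HasDerivAt (fun s => s ^ ((n : ℝ) - k) * (deriv v s) ^ k)
        (t ^ ((n:ℝ) - 1 + σ) * (- v t) ^ q) t := by
      rw [← h]
      apply DifferentiableAt.hasDerivAt
      apply differentiableAt_of_deriv_ne_zero
      rw [h]; exact (dpos t ht).ne'
    refine hd.congr_of_eventuallyEq ?_
    filter_upwards [Ioi_mem_nhds ht] with s hs using hye s hs
  have ypos : ∀ t, 0 < t → 0 < y t := by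
    intro t ht
    have := strictMonoOn_of_deriv_pos (convex_Ici 0) hyc (fun x hx => by
      rw [interior_Ici] at hx
      rw [(dy x hx).deriv]; exact dpos x hx) (mem_Ici.2 le_rfl) (mem_Ici.2 ht.le) ht
    rwa [hy0] at this
  have pne : ∀ t, 0 < t → deriv v t ≠ 0 := by
    intro t ht h0
    have := ypos t ht
    rw [hye t ht, h0, zero_pow (by omega), mul_zero] at this
    exact lt_irrefl _ this
  have sign : (∀ t, 0 < t → 0 < deriv v t) ∨ (∀ t, 0 < t → deriv v t < 0) := by
    by_contra! hcon
    obtain ⟨⟨a, ha, ha'⟩, b, hb, hb'⟩ := hcon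
    obtain ⟨c, hc, hc'⟩ := isPreconnected_Ioi.intermediate_value (s := Ioi (0:ℝ)) (mem_Ioi.2 ha)
      (mem_Ioi.2 hb) ddv.continuousOn ⟨ha', hb'⟩
    exact pne c hc hc'
  rcases sign with hpos | hneg
  · refine ⟨fun t => - v (max t 0), ?_⟩
    have hw : ∀ t, 0 ≤ t → (fun t => - v (max t 0)) t = - v t := fun t ht => by
      simp only; rw [max_eq_left ht]
    obtain ⟨w, hwdef⟩ : ∃ w : ℝ → ℝ, w = fun t => - v (max t 0) := ⟨_, rfl⟩
    rw [← hwdef] at hw ⊢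
    have wc : Continuous w := by
      rw [hwdef]
      exact (hvc.comp_continuous (continuous_id.max continuous_const) (fun t => mem_Ici.2 (le_max_right _ _))).neg
    have dw : ∀ t, 0 < t → HasDerivAt w (- deriv v t) t := by
      intro t ht
      refine (dv t ht).neg.congr_of_eventuallyEq ?_
      filter_upwards [Ioi_mem_nhds ht] with s hs using hw s (le_of_lt hs)
    have hYc : Continuous (Yop (n+σ) q w) :=
      continuous_iff_continuousAt.2 fun τ => (Yop_hasDerivAt hN hq0 wc τ).continuousAt
    have yY : ∀ t, 0 ≤ t → y t = Yop (n+σ) q w t := by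
      refine eq_Ici hyc hYc.continuousOn (by rw [hy0, Yop_zero]) dy ?_
      intro t ht
      refine (Yop_hasDerivAt hN hq0 wc t).congr_deriv ?_
      have := hvneg t ht.le
      rw [max_eq_left ht.le, hw t ht.le, fq_of_nonneg (by linarith)]
      congr 2; ring
    have pe : ∀ t, 0 < t → deriv v t = (max t 0) ^ (1 + σ * (1/(k:ℝ))) * (Aop (n+σ) q w t) ^ (1/(k:ℝ)) := by
      intro t ht
      have hA := Aop_nonneg (N := n + σ) (q := q) w t
      rw [max_eq_left ht.le]
      refine (pow_left_inj₀ (hpos t ht).le (by positivity) (n := k) (by omega)).1 ?_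
      have h := yY t ht.le
      rw [hye t ht, Yop_eq w ht] at h
      rw [mul_pow, ← Real.rpow_natCast (_ ^ (1 + σ * (1/(k:ℝ)))), ← Real.rpow_natCast (_ ^ (1/(k:ℝ))),
        ← Real.rpow_mul ht.le, ← Real.rpow_mul hA]
      have a1 : 1 / (k:ℝ) * k = 1 := by field_simp
      have a2 : (1 + σ * (1/(k:ℝ))) * k = k + σ := by field_simp
      rw [a1, a2, Real.rpow_one]
      have a3 : t ^ ((n:ℝ) + σ) = t ^ ((n:ℝ) - k) * t ^ (k + σ) := by
        rw [← Real.rpow_add ht]; congr 1; ring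
      rw [a3, mul_assoc] at h
      exact mul_left_cancel₀ (Real.rpow_pos_of_pos ht _).ne' h
    have fix : ∀ t, 0 ≤ t → Tp (n + σ) q (1 + σ * (1/k)) (1/k) w t = w t := by
      refine eq_Ici (Tp_cont hN hq0 hβ.le hκ.le wc).continuousOn wc.continuousOn ?_
        (d := fun t => - deriv v t) ?_ dw
      · rw [Tp_neg hβ _ le_rfl, hw 0 le_rfl, hv0]; norm_num
      · intro t ht
        refine (Tp_hasDerivAt hN hq0 hβ.le hκ.le wc t).congr_deriv ?_
        rw [pe t ht]
    have wle : ∀ t, 0 ≤ t → w t ≤ 1 := fun t ht => by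
      rw [← fix t ht]; exact Tp_le_one _ ht
    refine ⟨⟨wc, wle, fun t ht => ?_⟩, hw, fix⟩
    rw [← fix t ht.1]
    exact Tp_half hN hq0 hβ.le hκ.le wc wle t ht
  · exfalso
    have ev : Even k := by
      by_contra hodd
      rw [Nat.not_even_iff_odd] at hodd
      have h1 := ypos 1 one_pos
      rw [hye 1 one_pos, Real.one_rpow, one_mul] at h1
      exact absurd (hodd.pow_neg (hneg 1 one_pos)) (by linarith)
    refine blowup hk hn hq hσ (w := fun t => - v t) (p := fun t => - deriv v t) (y := y)
      (fun t ht => by linarith [hvneg t ht]) hvc.neg (fun t ht => (dv t ht).neg)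
      (fun t ht => by linarith [hneg t ht]) (fun t ht => (dp t ht).neg) hyc hy0 ?_ dy
    intro t ht
    rw [hye t ht, ev.neg_pow]

lemma exist_aux (hk : 1 ≤ k) (hn : 2 * k < n) (hq : (k : ℝ) < q) (hσ : 0 ≤ σ) {w : ℝ → ℝ}
    (hw : Adm w) (fw : ∀ t, Tp (n + σ) q (1 + σ * (1/k)) (1/k) w t = w t)
    (wpos : ∀ t, 0 ≤ t → 0 < w t) : IsIVPSol n k q σ (fun t => - w t) := by
  have hk1 : (1:ℝ) ≤ k := by exact_mod_cast hk
  have hk0 : (0:ℝ) < k := by linarith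
  have hn1 : 2 * (k:ℝ) < n := by exact_mod_cast hn
  have hN : 1 ≤ (n:ℝ) + σ := by linarith
  have hq0 : 0 ≤ q := by linarith
  have hκ : 0 < 1 / (k:ℝ) := by positivity
  have hβ : 0 < 1 + σ * (1/(k:ℝ)) := by positivity
  have dz : ∀ t, HasDerivAt (fun t => - w t)
      ((max t 0) ^ (1 + σ * (1/(k:ℝ))) * (Aop (n+σ) q w t) ^ (1/(k:ℝ))) t := by
    intro t
    have h := (Tp_hasDerivAt hN hq0 hβ.le hκ.le hw.cont t).neg
    rw [funext fw, neg_neg] at h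
    exact h
  have dze : deriv (fun t => - w t) =
      fun t => (max t 0) ^ (1 + σ * (1/(k:ℝ))) * (Aop (n+σ) q w t) ^ (1/(k:ℝ)) :=
    funext fun t => (dz t).deriv
  have zd : Differentiable ℝ (fun t => - w t) := fun t => (dz t).differentiableAt
  have YC : ContDiff ℝ 1 (Yop (n+σ) q w) := by
    rw [contDiff_one_iff_deriv]
    refine ⟨fun t => (Yop_hasDerivAt hN hq0 hw.cont t).differentiableAt, ?_⟩
    rw [funext fun t => (Yop_hasDerivAt hN hq0 hw.cont t).deriv]
    exact Y_integrand_cont hN hq0 hw.cont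
  refine ⟨?_, ?_, ?_, ?_, ?_, ?_⟩
  · have : ContDiffOn ℝ (1 + 1) (fun t => - w t) (Ioi 0) := by
      rw [contDiffOn_succ_iff_deriv_of_isOpen isOpen_Ioi]
      refine ⟨zd.differentiableOn, by simp, ?_⟩
      rw [dze]
      have h1 : ∀ p : ℝ, ContDiffOn ℝ 1 (fun t : ℝ => t ^ p) (Ioi 0) := fun p =>
        contDiffOn_id.rpow_const_of_ne (fun t ht => (ne_of_gt ht))
      have h2 : ContDiffOn ℝ 1 (fun t : ℝ => t ^ (1 + σ * (1/(k:ℝ))) *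
          (t ^ (-((n:ℝ) + σ)) * Yop (n+σ) q w t) ^ (1/(k:ℝ))) (Ioi 0) := by
        refine (h1 _).mul (((h1 _).mul YC.contDiffOn).rpow_const_of_ne ?_)
        intro t ht
        have ht' : 0 < t := ht
        have := Aop_pos hN hq0 hw ht'.le
        rw [Yop_eq w ht']
        positivity
      refine h2.congr ?_
      intro t ht
      have ht' : 0 < t := ht
      rw [max_eq_left ht'.le, Yop_eq w ht', ← mul_assoc, ← Real.rpow_add ht', neg_add_cancel,
        Real.rpow_zero, one_mul]
    simpa [one_add_one_eq_two] using this
  · apply ContDiff.contDiffOn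
    rw [contDiff_one_iff_deriv]
    refine ⟨zd, ?_⟩
    rw [dze]
    exact T_integrand_cont hN hq0 hβ.le hκ.le hw.cont
  · simp only
    rw [← fw 0, Tp_neg hβ _ le_rfl]
  · rw [dze]
    simp only
    rw [max_self, Real.zero_rpow hβ.ne', zero_mul]
  · intro t ht
    simpa using wpos t ht
  · intro t ht
    have h := Yop_hasDerivAt hN hq0 hw.cont t
    have e : (fun s => s ^ ((n : ℝ) - k) * (deriv (fun t => - w t) s) ^ k) =ᶠ[nhds t]
        Yop (n+σ) q w := by
      filter_upwards [Ioi_mem_nhds ht] with s hs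
      have hs' : 0 < s := hs
      have hA := Aop_nonneg (N := n + σ) (q := q) w s
      rw [dze]
      simp only
      rw [max_eq_left hs'.le, Yop_eq w hs', mul_pow, ← Real.rpow_natCast (_ ^ (1 + σ * (1/(k:ℝ)))),
        ← Real.rpow_natCast (_ ^ (1/(k:ℝ))), ← Real.rpow_mul hs'.le, ← Real.rpow_mul hA]
      have a1 : 1 / (k:ℝ) * k = 1 := by field_simp
      have a2 : (1 + σ * (1/(k:ℝ))) * k = k + σ := by field_simp
      rw [a1, a2, Real.rpow_one, ← mul_assoc, ← Real.rpow_add hs']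
      congr 2; ring
    rw [e.deriv_eq, h.deriv, max_eq_left ht.le, fq_of_nonneg (wpos t ht.le).le, neg_neg]
    congr 2; ring

end main

/-- if `q ≥ q*(k,σ)` the above initial value problem has a unique global
solution on `[0,∞)`. -/
theorem unique_global_solution_IVP (n k : ℕ) (hk : 1 ≤ k) (hn : 2 * k < n)
    (q σ : ℝ) (hq : (k : ℝ) < q) (hσ : 0 ≤ σ) (hqstar : qstar n k σ ≤ q) :
    ∃ z : ℝ → ℝ, IsIVPSol n k q σ z ∧
      ∀ z' : ℝ → ℝ, IsIVPSol n k q σ z' → EqOn z' z (Ici 0) := by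
  have hk1 : (1:ℝ) ≤ k := by exact_mod_cast hk
  have hk0 : (0:ℝ) < k := by linarith
  have hn1 : 2 * (k:ℝ) < n := by exact_mod_cast hn
  have hN : 1 ≤ (n:ℝ) + σ := by linarith
  have hq1 : 1 < q := by linarith
  have hκ : 0 < 1 / (k:ℝ) := by positivity
  have hκ1 : 1 / (k:ℝ) ≤ 1 := by rw [div_le_one hk0]; exact hk1
  have hβ : 0 < 1 + σ * (1/(k:ℝ)) := by positivity
  obtain ⟨w, hw, fw⟩ := fixed_exists hN hq1 hβ hκ hκ1
  have hce : ((n:ℝ) * (1/k) - 2) / (1 + 1/k) = (n - 2 * k) / (k + 1) := by field_simp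
  have wpos : ∀ t, 0 ≤ t → 0 < w t := by
    refine fixed_pos hN hq1 hσ hκ ?_ ?_ hw fw
    · rw [hce]; exact div_nonneg (by linarith) (by linarith)
    · rw [hce, div_le_div_iff₀ (by linarith) (by linarith)]
      unfold qstar at hqstar
      rw [div_le_iff₀ (by linarith)] at hqstar
      nlinarith
  refine ⟨fun t => - w t, exist_aux hk hn hq hσ hw fw wpos, ?_⟩
  intro v hv t ht
  obtain ⟨u, hu, huv, fu⟩ := uniq_aux hk hn hq hσ hv
  have := fixed_unique hN hq1 hβ.le hκ hκ1 hw hu (fun t _ => fw t) fu t ht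
  rw [huv t ht] at this
  simp only
  linarith
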